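/- Let E be a rank-r orthogonal projection on ℂ^d and let |u⟩ be a Haar-random unit vector in ℂ^d. Then for any positive integer k, E[‖E|u⟩‖₂^{2k}] = Tr(E^{⊗k} Π_S)/dim(S) ≤ r^k · k! / ((d+k−1)(d+k−2)⋯d) ≤ (rk/d)^k. -/

import Mathlib

open Matrix MeasureTheory
open scoped ComplexOrder

/-- The k-th tensor power `E^{⊗k}` of a matrix, realized on the index set `Fin k → Fin d`. -/
noncomputable def matTensorPow {d : ℕ} (k : ℕ) (E : Matrix (Fin d) (Fin d) ℂ) :
    Matrix (Fin k → Fin d) (Fin k → Fin d) ℂ :=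
  fun i j => ∏ t, E (i t) (j t)

/-- The permutation operator `P_π` on `(ℂ^d)^{⊗k}`. -/
noncomputable def permOp (d k : ℕ) (π : Equiv.Perm (Fin k)) :
    Matrix (Fin k → Fin d) (Fin k → Fin d) ℂ :=
  fun i j => if (fun t => i (π t)) = j then 1 else 0

/-- The orthogonal projector onto the symmetric subspace of `(ℂ^d)^{⊗k}`. -/
noncomputable def symProj (d k : ℕ) : Matrix (Fin k → Fin d) (Fin k → Fin d) ℂ :=
  ((k.factorial : ℂ))⁻¹ • ∑ π : Equiv.Perm (Fin k), permOp d k π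


lemma perm_iff_exists {α : Type*} [LinearOrder α] {k : ℕ} (f g : Fin k → α) :
    (List.ofFn f).Perm (List.ofFn g) ↔ ∃ π : Equiv.Perm (Fin k), f = g ∘ π := by
  constructor
  · intro h
    have h1 : List.ofFn (f ∘ Tuple.sort f) = List.ofFn (g ∘ Tuple.sort g) := by
      refine List.Perm.eq_of_pairwise' (r := (· ≤ ·)) ?_ ?_ ?_
      · exact (show Monotone (f ∘ Tuple.sort f) from Tuple.monotone_sort f).sortedLE_ofFn.pairwise
      · exact (show Monotone (g ∘ Tuple.sort g) from Tuple.monotone_sort g).sortedLE_ofFn.pairwise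
      · exact ((Tuple.sort f).ofFn_comp_perm f).trans (h.trans ((Tuple.sort g).ofFn_comp_perm g).symm)
    have h2 := List.ofFn_injective h1
    refine ⟨(Tuple.sort f).symm.trans (Tuple.sort g), ?_⟩
    funext x
    have := congrFun h2 ((Tuple.sort f).symm x)
    simpa using this
  · rintro ⟨π, rfl⟩
    exact π.ofFn_comp_perm g

noncomputable def orbitsEquivSym (α : Type*) [LinearOrder α] (k : ℕ) :
    MulAction.orbitRel.Quotient (Equiv.Perm (Fin k))ᵈᵐᵃ (Fin k → α) ≃ Sym α k :=
  Equiv.ofBijective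
    (Quotient.lift (fun f => (⟨(List.ofFn f : Multiset α), by simp⟩ : Sym α k)) (by
      rintro f g ⟨π, rfl⟩
      apply Subtype.ext
      exact Multiset.coe_eq_coe.2 ((DomMulAct.mk.symm π).ofFn_comp_perm g)))
    (by
      constructor
      · intro a b
        refine Quotient.inductionOn₂ a b ?_
        intro f g h
        have h' := Multiset.coe_eq_coe.1 (congrArg Subtype.val h)
        obtain ⟨π, hπ⟩ := (perm_iff_exists f g).1 h'
        exact Quotient.sound ⟨DomMulAct.mk π, hπ.symm⟩
      · rintro ⟨m, hm⟩
        induction m using Quotient.inductionOn with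
        | h l =>
          have hl : l.length = k := by simpa using hm
          subst hl
          refine ⟨Quotient.mk _ (fun i => l.get i), ?_⟩
          apply Subtype.ext
          show ((List.ofFn (fun i => l.get i) : List α) : Multiset α) = (l : Multiset α)
          rw [List.ofFn_get])

lemma burnside_count (α : Type*) [LinearOrder α] [Fintype α] (k : ℕ) :
    ∑ π : Equiv.Perm (Fin k), Nat.card {f : Fin k → α // (fun t => f (π t)) = f} =
      (Fintype.card α + k - 1).choose k * k.factorial := by
  classical
  have := Fintype.ofEquiv _ (DomMulAct.mk (M := Equiv.Perm (Fin k)))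
  have := Fintype.ofEquiv _ (orbitsEquivSym α k).symm
  have h := MulAction.sum_card_fixedBy_eq_card_orbits_mul_card_group
    (Equiv.Perm (Fin k))ᵈᵐᵃ (Fin k → α)
  rw [Fintype.card_congr (orbitsEquivSym α k), Sym.card_sym_eq_choose,
    Fintype.card_congr (DomMulAct.mk (M := Equiv.Perm (Fin k))).symm, Fintype.card_perm, Fintype.card_fin] at h
  rw [← h]
  refine Fintype.sum_equiv DomMulAct.mk _ _ ?_
  intro π
  rw [← Nat.card_eq_fintype_card]
  refine Nat.card_congr (Equiv.subtypeEquivRight ?_)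
  intro f
  rfl

lemma matTensorPow_mul {d : ℕ} (k : ℕ) (A B : Matrix (Fin d) (Fin d) ℂ) :
    matTensorPow k (A * B) = matTensorPow k A * matTensorPow k B := by
  ext i j
  simp only [matTensorPow, Matrix.mul_apply, ← Finset.prod_mul_distrib]
  rw [Finset.prod_univ_sum]
  simp

lemma matTensorPow_one {d : ℕ} (k : ℕ) :
    matTensorPow k (1 : Matrix (Fin d) (Fin d) ℂ) = 1 := by
  ext i j
  simp only [matTensorPow, Matrix.one_apply]
  by_cases h : i = j
  · simp [h]
  · rw [if_neg h]
    obtain ⟨t, ht⟩ := Function.ne_iff.1 h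
    exact Finset.prod_eq_zero (Finset.mem_univ t) (if_neg ht)

lemma permOp_comm {d : ℕ} (k : ℕ) (A : Matrix (Fin d) (Fin d) ℂ) (π : Equiv.Perm (Fin k)) :
    matTensorPow k A * permOp d k π = permOp d k π * matTensorPow k A := by
  ext i j
  simp only [matTensorPow, permOp, Matrix.mul_apply, ite_mul, one_mul, zero_mul, mul_ite, mul_one,
    mul_zero]
  rw [Finset.sum_ite_eq, if_pos (Finset.mem_univ _)]
  rw [Finset.sum_eq_single (fun t => j (π.symm t))]
  · rw [if_pos (by simp)]
    exact Fintype.prod_equiv π.symm _ _ (by intro x; simp)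
  · intro b _ hb
    rw [if_neg]
    rintro rfl
    simp at hb
  · simp

lemma trace_diag {d : ℕ} (k : ℕ) (e : Fin d → ℝ) (he : ∀ i, e i = 0 ∨ e i = 1) :
    (matTensorPow k (Matrix.diagonal (fun i => (e i : ℂ))) * symProj d k).trace =
      ((Fintype.card {i // e i ≠ 0} + k - 1).choose k : ℂ) := by
  classical
  have hb := burnside_count {i // e i ≠ 0} k
  have hπ : ∀ π : Equiv.Perm (Fin k),
      (matTensorPow k (Matrix.diagonal (fun i => (e i : ℂ))) * permOp d k π).trace =
      (Nat.card {f : Fin k → {i // e i ≠ 0} // (fun t => f (π t)) = f} : ℂ) := by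
    intro π
    rw [permOp_comm]
    have h1 : ∀ i : Fin k → Fin d, (permOp d k π *
        matTensorPow k (Matrix.diagonal (fun i => (e i : ℂ)))) i i =
        if (fun t => i (π t)) = i ∧ ∀ t, e (i t) ≠ 0 then 1 else 0 := by
      intro i
      simp only [matTensorPow, permOp, Matrix.mul_apply, ite_mul, one_mul, zero_mul]
      rw [Finset.sum_ite_eq, if_pos (Finset.mem_univ _)]
      split_ifs with h
      · obtain ⟨h, h'⟩ := h
        apply Finset.prod_eq_one
        intro t _
        have ht : i (π t) = i t := congrFun h t
        simp only [ht]
        rw [Matrix.diagonal_apply_eq]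
        rcases he (i t) with h0 | h0
        · exact absurd h0 (h' t)
        · simp [h0]
      · rw [not_and_or] at h
        rcases h with h | h
        · obtain ⟨t, ht⟩ := Function.ne_iff.1 h
          exact Finset.prod_eq_zero (Finset.mem_univ t) (Matrix.diagonal_apply_ne _ ht)
        · push Not at h
          obtain ⟨t, ht⟩ := h
          refine Finset.prod_eq_zero (Finset.mem_univ (π.symm t)) ?_
          simp only [Equiv.apply_symm_apply]
          rw [Matrix.diagonal_apply]
          simp [ht]
    simp only [Matrix.trace, Matrix.diag_apply, h1]
    rw [Finset.sum_boole, ← Fintype.card_subtype, ← Nat.card_eq_fintype_card]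
    congr 1
    refine Nat.card_congr ?_
    refine ⟨fun f => ⟨fun t => ⟨f.1 t, f.2.2 t⟩, ?_⟩, fun f => ⟨fun t => (f.1 t).1, ?_, ?_⟩, ?_, ?_⟩
    · funext t; exact Subtype.ext (congrFun f.2.1 t)
    · funext t; exact congrArg Subtype.val (congrFun f.2 t)
    · intro t; exact (f.1 t).2
    · intro f; rfl
    · intro f; rfl
  simp only [symProj, Matrix.mul_smul, Matrix.trace_smul, Matrix.mul_sum, Matrix.trace_sum, hπ]
  rw [← Nat.cast_sum, hb]
  have : (k.factorial : ℂ) ≠ 0 := by exact_mod_cast k.factorial_ne_zero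
  push_cast
  rw [smul_eq_mul]
  field_simp

lemma trace_conj {d : ℕ} (k : ℕ) (U D : Matrix (Fin d) (Fin d) ℂ) (hU : star U * U = 1) :
    (matTensorPow k (U * D * star U) * symProj d k).trace =
      (matTensorPow k D * symProj d k).trace := by
  have hc : matTensorPow k (star U) * symProj d k = symProj d k * matTensorPow k (star U) := by
    simp only [symProj, Matrix.mul_smul, Matrix.smul_mul, Matrix.mul_sum, Matrix.sum_mul, permOp_comm]
  rw [matTensorPow_mul, matTensorPow_mul, Matrix.mul_assoc, hc, Matrix.mul_assoc,
    Matrix.trace_mul_comm, Matrix.mul_assoc, Matrix.mul_assoc, ← matTensorPow_mul, hU, 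
    matTensorPow_one, Matrix.mul_one]

lemma integrable_of_cont {d : ℕ} (μ : Measure (Fin d → ℂ)) [IsProbabilityMeasure μ]
    (hunit : ∀ᵐ u ∂μ, ∑ i, ‖u i‖ ^ 2 = 1) (F : (Fin d → ℂ) → ℝ) (hF : Continuous F) :
    Integrable F μ := by
  obtain ⟨C, hC⟩ := (isCompact_closedBall (0 : Fin d → ℂ) 1).exists_bound_of_continuousOn
    hF.continuousOn
  refine Integrable.of_bound hF.aestronglyMeasurable C ?_
  filter_upwards [hunit] with u hu
  apply hC
  rw [mem_closedBall_zero_iff, pi_norm_le_iff_of_nonneg zero_le_one]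
  intro i
  have := Finset.single_le_sum (f := fun i => ‖u i‖ ^ 2) (fun i _ => by positivity)
    (Finset.mem_univ i)
  simp only [hu] at this
  nlinarith [norm_nonneg (u i)]

lemma integral_unitary_inv {d : ℕ} (μ : Measure (Fin d → ℂ))
    (hinv : ∀ U ∈ Matrix.unitaryGroup (Fin d) ℂ, Measure.map (fun u => U *ᵥ u) μ = μ)
    (U : Matrix (Fin d) (Fin d) ℂ) (hU : U ∈ Matrix.unitaryGroup (Fin d) ℂ)
    (F : (Fin d → ℂ) → ℝ) (hF : Continuous F) :
    ∫ u, F (U *ᵥ u) ∂μ = ∫ u, F u ∂μ := by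
  have hc : Continuous (fun u : Fin d → ℂ => U *ᵥ u) := by fun_prop
  conv_rhs => rw [← hinv U hU]
  rw [integral_map hc.aemeasurable hF.aestronglyMeasurable]

noncomputable def rotM {d : ℕ} (i j : Fin d) (c s : ℝ) : Matrix (Fin d) (Fin d) ℂ :=
  1 + ((c : ℂ) - 1) • (Matrix.single i i 1 + Matrix.single j j 1) +
    (s : ℂ) • (Matrix.single j i 1 - Matrix.single i j 1)

lemma rotM_mulVec {d : ℕ} (i j : Fin d) (hij : i ≠ j) (c s : ℝ) (u : Fin d → ℂ) :
    (rotM i j c s *ᵥ u) i = c * u i - s * u j ∧ (rotM i j c s *ᵥ u) j = s * u i + c * u j ∧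
    ∀ a, a ≠ i → a ≠ j → (rotM i j c s *ᵥ u) a = u a := by
  have h : ∀ a, (rotM i j c s *ᵥ u) a = u a + ((c : ℂ) - 1) * ((if a = i then u i else 0) +
      (if a = j then u j else 0)) + s * ((if a = j then u i else 0) - (if a = i then u j else 0)) := by
    intro a
    simp [rotM, Matrix.add_mulVec, Matrix.sub_mulVec, Matrix.smul_mulVec, Matrix.single_mulVec,
      Function.update_apply]
    split_ifs <;> ring
  refine ⟨?_, ?_, ?_⟩
  · rw [h]; simp [hij]; ring
  · rw [h]; simp [hij.symm]; ring
  · intro a h1 h2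
    rw [h]; simp [h1, h2]

lemma rotM_mem {d : ℕ} (i j : Fin d) (hij : i ≠ j) (c s : ℝ) (hcs : c ^ 2 + s ^ 2 = 1) :
    rotM i j c s ∈ Matrix.unitaryGroup (Fin d) ℂ := by
  have hcs' : (c : ℂ) * c + s * s = 1 := by
    have : ((c ^ 2 + s ^ 2 : ℝ) : ℂ) = 1 := by rw [hcs]; simp
    push_cast at this
    linear_combination this
  rw [Matrix.mem_unitaryGroup_iff]
  have hs : star (rotM i j c s) = rotM i j c (-s) := by
    rw [Matrix.star_eq_conjTranspose]
    simp only [rotM, Matrix.conjTranspose_add, Matrix.conjTranspose_sub, Matrix.conjTranspose_smul,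
      Matrix.conjTranspose_one, Matrix.conjTranspose_single]
    simp only [star_sub, star_one, Complex.star_def, Complex.conj_ofReal, Complex.ofReal_neg]
    module
  rw [hs]
  apply Matrix.ext_of_mulVec_single
  intro a
  rw [← Matrix.mulVec_mulVec, Matrix.one_mulVec]
  generalize (Pi.single a 1 : Fin d → ℂ) = u
  obtain ⟨h1, h2, h3⟩ := rotM_mulVec i j hij c s (rotM i j c (-s) *ᵥ u)
  obtain ⟨g1, g2, g3⟩ := rotM_mulVec i j hij c (-s) u
  push_cast at g1 g2
  funext b
  by_cases hb : b = i
  · subst hb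
    rw [h1, g1, g2]; linear_combination (u b) * hcs'
  · by_cases hb2 : b = j
    · subst hb2
      rw [h2, g1, g2]; linear_combination (u b) * hcs'
    · rw [h3 b hb hb2, g3 b hb hb2]

lemma phase_mem {d : ℕ} (i : Fin d) :
    Matrix.diagonal (fun a => if a = i then Complex.I else 1) ∈ Matrix.unitaryGroup (Fin d) ℂ := by
  rw [Matrix.mem_unitaryGroup_iff, Matrix.star_eq_conjTranspose, Matrix.diagonal_conjTranspose,
    Matrix.diagonal_mul_diagonal, ← Matrix.diagonal_one]
  congr 1
  funext a
  by_cases h : a = i <;> simp [h]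

/-- overlap with coordinate subspace -/
noncomputable def XX {d : ℕ} (S : Finset (Fin d)) (u : Fin d → ℂ) : ℝ := ∑ a ∈ S, ‖u a‖ ^ 2

lemma XX_cont {d : ℕ} (S : Finset (Fin d)) : Continuous (XX S) := by
  unfold XX; fun_prop

noncomputable def ww {d : ℕ} (i j : Fin d) (u : Fin d → ℂ) : ℝ :=
  (u i).re * (u j).re + (u i).im * (u j).im

lemma ww_cont {d : ℕ} (i j : Fin d) : Continuous (ww i j) := by
  unfold ww; fun_prop

lemma rot_formula {d : ℕ} (S : Finset (Fin d)) (i j : Fin d) (hi : i ∈ S) (hj : j ∉ S) (c s : ℝ)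
    (hcs : c ^ 2 + s ^ 2 = 1) (u : Fin d → ℂ) :
    ww i j (rotM i j c s *ᵥ u) =
      c * s * (‖u i‖ ^ 2 - ‖u j‖ ^ 2) + (c ^ 2 - s ^ 2) * ww i j u ∧
    XX S (rotM i j c s *ᵥ u) =
      XX S u + s ^ 2 * (‖u j‖ ^ 2 - ‖u i‖ ^ 2) - 2 * (c * s) * ww i j u := by
  have hij : i ≠ j := by rintro rfl; exact hj hi
  obtain ⟨h1, h2, h3⟩ := rotM_mulVec i j hij c s u
  constructor
  · simp only [ww, h1, h2, Complex.sq_norm, Complex.normSq_apply]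
    simp
    ring
  · simp only [XX]
    rw [← Finset.add_sum_erase S _ hi, ← Finset.add_sum_erase S (fun a => ‖u a‖ ^ 2) hi]
    have : ∑ x ∈ S.erase i, ‖(rotM i j c s *ᵥ u) x‖ ^ 2 = ∑ x ∈ S.erase i, ‖u x‖ ^ 2 := by
      apply Finset.sum_congr rfl
      intro x hx
      rw [h3 x (Finset.ne_of_mem_erase hx)]
      rintro rfl
      exact hj (Finset.mem_of_mem_erase hx)
    rw [this, h1]
    simp only [ww, Complex.sq_norm, Complex.normSq_apply]
    simp
    have : c ^ 2 = 1 - s ^ 2 := by linarith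
    ring_nf
    rw [this]
    ring

lemma deriv_under {d : ℕ} (μ : Measure (Fin d → ℂ)) [IsProbabilityMeasure μ]
    (hunit : ∀ᵐ u ∂μ, ∑ i, ‖u i‖ ^ 2 = 1) (F F' : ℝ → (Fin d → ℂ) → ℝ)
    (hFc : ∀ θ, Continuous (F θ)) (hF'c : Continuous (fun p : ℝ × (Fin d → ℂ) => F' p.1 p.2))
    (hder : ∀ u θ, HasDerivAt (fun θ => F θ u) (F' θ u) θ) :
    HasDerivAt (fun θ => ∫ u, F θ u ∂μ) (∫ u, F' 0 u ∂μ) 0 := by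
  obtain ⟨C, hC⟩ := ((isCompact_Icc (a := (-1 : ℝ)) (b := 1)).prod
    (isCompact_closedBall (0 : Fin d → ℂ) 1)).exists_bound_of_continuousOn hF'c.continuousOn
  exact (hasDerivAt_integral_of_dominated_loc_of_deriv_le (μ := μ) (F := F) (F' := F')
    (x₀ := (0 : ℝ)) (s := Set.Icc (-1) 1) (bound := fun _ => C)
    (Icc_mem_nhds (by norm_num) (by norm_num))
    (Filter.Eventually.of_forall fun θ => (hFc θ).aestronglyMeasurable)
    (integrable_of_cont μ hunit _ (hFc 0))
    (by
      have : Continuous (F' 0) := by fun_prop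
      exact this.aestronglyMeasurable)
    (by
      filter_upwards [hunit] with u hu
      intro θ hθ
      refine hC (θ, u) ⟨hθ, ?_⟩
      rw [mem_closedBall_zero_iff, pi_norm_le_iff_of_nonneg zero_le_one]
      intro i
      have := Finset.single_le_sum (f := fun i => ‖u i‖ ^ 2) (fun i _ => by positivity)
        (Finset.mem_univ i)
      simp only [hu] at this
      nlinarith [norm_nonneg (u i)])
    (integrable_const _)
    (Filter.Eventually.of_forall fun u θ _ => hder u θ)).2

lemma key_deriv {d : ℕ} (μ : Measure (Fin d → ℂ)) [IsProbabilityMeasure μ]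
    (hunit : ∀ᵐ u ∂μ, ∑ i, ‖u i‖ ^ 2 = 1)
    (hinv : ∀ U ∈ Matrix.unitaryGroup (Fin d) ℂ, Measure.map (fun u => U *ᵥ u) μ = μ)
    (S : Finset (Fin d)) (i j : Fin d) (hi : i ∈ S) (hj : j ∉ S) (k : ℕ) :
    ∫ u, ((‖u i‖ ^ 2 - ‖u j‖ ^ 2) * XX S u ^ k - 2 * k * (ww i j u ^ 2 * XX S u ^ (k - 1))) ∂μ
      = 0 := by
  have hij : i ≠ j := by rintro rfl; exact hj hi
  have hX := XX_cont S
  have hw := ww_cont i j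
  let P : ℝ → (Fin d → ℂ) → ℝ := fun θ u =>
    Real.cos θ * Real.sin θ * (‖u i‖ ^ 2 - ‖u j‖ ^ 2) + (Real.cos θ ^ 2 - Real.sin θ ^ 2) * ww i j u
  let Q : ℝ → (Fin d → ℂ) → ℝ := fun θ u =>
    XX S u + Real.sin θ ^ 2 * (‖u j‖ ^ 2 - ‖u i‖ ^ 2) - 2 * (Real.cos θ * Real.sin θ) * ww i j u
  let P' : ℝ → (Fin d → ℂ) → ℝ := fun θ u =>
    (-Real.sin θ * Real.sin θ + Real.cos θ * Real.cos θ) * (‖u i‖ ^ 2 - ‖u j‖ ^ 2)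
      + (2 * Real.cos θ * (-Real.sin θ) - 2 * Real.sin θ * Real.cos θ) * ww i j u
  let Q' : ℝ → (Fin d → ℂ) → ℝ := fun θ u =>
    (2 * Real.sin θ * Real.cos θ) * (‖u j‖ ^ 2 - ‖u i‖ ^ 2) -
      2 * (-Real.sin θ * Real.sin θ + Real.cos θ * Real.cos θ) * ww i j u
  let F : ℝ → (Fin d → ℂ) → ℝ := fun θ u => P θ u * Q θ u ^ k
  let F' : ℝ → (Fin d → ℂ) → ℝ := fun θ u =>
    P' θ u * Q θ u ^ k + P θ u * (k * Q θ u ^ (k - 1) * Q' θ u)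
  have hF'c : Continuous (fun p : ℝ × (Fin d → ℂ) => F' p.1 p.2) := by
    simp only [F', P, P', Q, Q']; fun_prop
  have hFc : ∀ θ, Continuous (F θ) := by
    intro θ; simp only [F, P, Q]; fun_prop
  have hder : ∀ u θ, HasDerivAt (fun θ => F θ u) (F' θ u) θ := by
    intro u θ
    have hcs := (Real.hasDerivAt_cos θ).mul (Real.hasDerivAt_sin θ)
    have hs2 := (Real.hasDerivAt_sin θ).pow 2
    have hc2 := (Real.hasDerivAt_cos θ).pow 2
    have hP : HasDerivAt (fun θ => P θ u) (P' θ u) θ := by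
      have := (hcs.mul_const (‖u i‖ ^ 2 - ‖u j‖ ^ 2)).add ((hc2.sub hs2).mul_const (ww i j u))
      refine this.congr_deriv ?_
      simp [P']
    have hQ : HasDerivAt (fun θ => Q θ u) (Q' θ u) θ := by
      have := ((hs2.mul_const (‖u j‖ ^ 2 - ‖u i‖ ^ 2)).const_add (XX S u)).sub
        ((hcs.const_mul 2).mul_const (ww i j u))
      refine this.congr_deriv ?_
      simp [Q']
    exact hP.mul (hQ.pow k)
  have hD := deriv_under μ hunit F F' hFc hF'c hder
  have hconst : (fun θ => ∫ u, F θ u ∂μ) = fun _ => ∫ u, ww i j u * XX S u ^ k ∂μ := by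
    funext θ
    rw [← integral_unitary_inv μ hinv (rotM i j (Real.cos θ) (Real.sin θ))
      (rotM_mem i j hij _ _ (Real.cos_sq_add_sin_sq θ)) (fun u => ww i j u * XX S u ^ k)
      (by fun_prop)]
    congr 1
    funext u
    obtain ⟨h1, h2⟩ := rot_formula S i j hi hj _ _ (Real.cos_sq_add_sin_sq θ) u
    simp only [F, P, Q, h1, h2]
  have h0 := hD
  rw [hconst] at h0
  have := h0.unique (hasDerivAt_const (0:ℝ) _)
  rw [← this]
  congr 1
  funext u
  simp [F', P, P', Q, Q']
  ring

lemma key_phase {d : ℕ} (μ : Measure (Fin d → ℂ)) [IsProbabilityMeasure μ]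
    (hunit : ∀ᵐ u ∂μ, ∑ i, ‖u i‖ ^ 2 = 1)
    (hinv : ∀ U ∈ Matrix.unitaryGroup (Fin d) ℂ, Measure.map (fun u => U *ᵥ u) μ = μ)
    (S : Finset (Fin d)) (i j : Fin d) (hij : i ≠ j) (k : ℕ) :
    2 * ∫ u, ww i j u ^ 2 * XX S u ^ k ∂μ = ∫ u, ‖u i‖ ^ 2 * ‖u j‖ ^ 2 * XX S u ^ k ∂μ := by
  have hX := XX_cont S
  have hw := ww_cont i j
  have h := integral_unitary_inv μ hinv _ (phase_mem i) (fun u => ww i j u ^ 2 * XX S u ^ k) (by fun_prop)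
  rw [two_mul]
  nth_rewrite 1 [← h]
  rw [← integral_add]
  · congr 1
    funext u
    have hXX : XX S (Matrix.diagonal (fun a => if a = i then Complex.I else 1) *ᵥ u) = XX S u := by
      simp only [XX, Matrix.mulVec_diagonal]
      apply Finset.sum_congr rfl
      intro a _
      by_cases h : a = i <;> simp [h]
    simp only [hXX]
    simp only [ww, Matrix.mulVec_diagonal, Complex.sq_norm, Complex.normSq_apply]
    simp [hij.symm]
    ring
  · apply integrable_of_cont μ hunit
    have hc : Continuous (fun u : Fin d → ℂ =>
        Matrix.diagonal (fun a => if a = i then Complex.I else 1) *ᵥ u) := by fun_prop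
    exact ((hw.comp hc).pow 2).mul ((hX.comp hc).pow k)
  · exact integrable_of_cont μ hunit _ (by fun_prop)

lemma key_rec {d : ℕ} (μ : Measure (Fin d → ℂ)) [IsProbabilityMeasure μ]
    (hunit : ∀ᵐ u ∂μ, ∑ i, ‖u i‖ ^ 2 = 1)
    (hinv : ∀ U ∈ Matrix.unitaryGroup (Fin d) ℂ, Measure.map (fun u => U *ᵥ u) μ = μ)
    (S : Finset (Fin d)) (k : ℕ) :
    ((d : ℝ) + k) * ∫ u, XX S u ^ (k + 1) ∂μ = ((S.card : ℝ) + k) * ∫ u, XX S u ^ k ∂μ := by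
  have hX := XX_cont S
  have h1 : ∀ i ∈ S, ∀ j ∈ Sᶜ, ∫ u, ((‖u i‖ ^ 2 - ‖u j‖ ^ 2) * XX S u ^ k -
      k * (‖u i‖ ^ 2 * ‖u j‖ ^ 2 * XX S u ^ (k - 1))) ∂μ = 0 := by
    intro i hi j hj
    have hj' : j ∉ S := by simpa using hj
    have hw := ww_cont i j
    rw [← key_deriv μ hunit hinv S i j hi hj' k]
    rw [integral_sub, integral_sub, integral_const_mul, integral_const_mul,
      ← key_phase μ hunit hinv S i j (by rintro rfl; exact hj' hi)]
    · ring
    all_goals exact integrable_of_cont μ hunit _ (by fun_prop)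
  have h2 : ∫ u, ∑ i ∈ S, ∑ j ∈ Sᶜ, ((‖u i‖ ^ 2 - ‖u j‖ ^ 2) * XX S u ^ k -
      k * (‖u i‖ ^ 2 * ‖u j‖ ^ 2 * XX S u ^ (k - 1))) ∂μ = 0 := by
    rw [integral_finsetSum]
    · apply Finset.sum_eq_zero
      intro i hi
      rw [integral_finsetSum]
      · exact Finset.sum_eq_zero fun j hj => h1 i hi j hj
      · intro j _
        exact integrable_of_cont μ hunit _ (by fun_prop)
    · intro i _
      exact integrable_of_cont μ hunit _ (by fun_prop)
  have h3 : ∫ u, (((d : ℝ) + k) * XX S u ^ (k + 1) - ((S.card : ℝ) + k) * XX S u ^ k) ∂μ = 0 := by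
    rw [← h2]
    apply integral_congr_ae
    filter_upwards [hunit] with u hu
    have hc : ∑ j ∈ Sᶜ, ‖u j‖ ^ 2 = 1 - XX S u := by
      rw [← hu, ← Finset.sum_add_sum_compl S]; simp [XX]
    have hcard : ((Sᶜ.card : ℕ) : ℝ) = d - S.card := by
      rw [Finset.card_compl, Nat.cast_sub (Finset.card_le_univ S)]; simp
    have hk : (k : ℝ) * (XX S u * XX S u ^ (k - 1)) = k * XX S u ^ k := by
      cases k with
      | zero => simp
      | succ n => simp [pow_succ]; left; ring
    have e1 : ∀ i, ∑ j ∈ Sᶜ, ((‖u i‖ ^ 2 - ‖u j‖ ^ 2) * XX S u ^ k -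
        k * (‖u i‖ ^ 2 * ‖u j‖ ^ 2 * XX S u ^ (k - 1))) =
        ‖u i‖ ^ 2 * ((d - S.card) * XX S u ^ k - k * (1 - XX S u) * XX S u ^ (k - 1))
          - (1 - XX S u) * XX S u ^ k := by
      intro i
      rw [← hc, ← hcard, Finset.sum_sub_distrib, ← Finset.sum_mul, Finset.sum_sub_distrib,
        Finset.sum_const, ← Finset.mul_sum, ← Finset.sum_mul, ← Finset.mul_sum, nsmul_eq_mul]
      ring
    simp only [e1]
    rw [Finset.sum_sub_distrib, ← Finset.sum_mul, Finset.sum_const, nsmul_eq_mul]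
    change _ = XX S u * _ - _
    rw [pow_succ]
    linear_combination (1 - XX S u) * hk
  rw [integral_sub, integral_const_mul, integral_const_mul] at h3
  · linarith
  all_goals exact integrable_of_cont μ hunit _ (by fun_prop)

lemma moment_eq {d : ℕ} (hd : 0 < d) (μ : Measure (Fin d → ℂ)) [IsProbabilityMeasure μ]
    (hunit : ∀ᵐ u ∂μ, ∑ i, ‖u i‖ ^ 2 = 1)
    (hinv : ∀ U ∈ Matrix.unitaryGroup (Fin d) ℂ, Measure.map (fun u => U *ᵥ u) μ = μ)
    (S : Finset (Fin d)) (k : ℕ) :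
    ∫ u, XX S u ^ k ∂μ =
      (∏ j ∈ Finset.range k, ((S.card : ℝ) + j)) / ∏ j ∈ Finset.range k, ((d : ℝ) + j) := by
  induction k with
  | zero => simp
  | succ k ih =>
    have h := key_rec μ hunit hinv S k
    have hd' : (0 : ℝ) < d := by exact_mod_cast hd
    have hp : (0 : ℝ) < ∏ j ∈ Finset.range k, ((d : ℝ) + j) :=
      Finset.prod_pos fun j _ => by positivity
    rw [ih] at h
    rw [Finset.prod_range_succ, Finset.prod_range_succ]
    have : (0 : ℝ) < d + k := by positivity
    field_simp
    field_simp at h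
    linarith

lemma prod_eq_choose (n k : ℕ) :
    ∏ j ∈ Finset.range k, ((n : ℝ) + j) = k.factorial * ((n + k - 1).choose k : ℝ) := by
  have h1 := Nat.ascFactorial_eq_prod_range n k
  rw [Nat.ascFactorial_eq_factorial_mul_choose'] at h1
  exact_mod_cast h1.symm

theorem moment_overlap_projection {d k r : ℕ} (hd : 0 < d) (hk : 0 < k)
    (E : Matrix (Fin d) (Fin d) ℂ) (hE : E.IsHermitian) (hE2 : E * E = E)
    (hrank : E.rank = r)
    (μ : Measure (Fin d → ℂ)) [IsProbabilityMeasure μ]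
    (hunit : ∀ᵐ u ∂μ, ∑ i, ‖u i‖ ^ 2 = 1)
    (hinv : ∀ U ∈ Matrix.unitaryGroup (Fin d) ℂ,
      Measure.map (fun u => U *ᵥ u) μ = μ) :
    (∫ u, ((star u ⬝ᵥ (E *ᵥ u)).re) ^ k ∂μ) =
      (((matTensorPow k E * symProj d k).trace).re) / (Nat.choose (d + k - 1) k) ∧
    (((matTensorPow k E * symProj d k).trace).re) / (Nat.choose (d + k - 1) k) ≤
      (r : ℝ) ^ k * k.factorial / ∏ j ∈ Finset.range k, ((d : ℝ) + j) ∧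
    (r : ℝ) ^ k * k.factorial / (∏ j ∈ Finset.range k, ((d : ℝ) + j)) ≤
      ((r : ℝ) * k / d) ^ k := by
  classical
  have hd' : (0 : ℝ) < d := by exact_mod_cast hd
  have hp : (0 : ℝ) < ∏ j ∈ Finset.range k, ((d : ℝ) + j) :=
    Finset.prod_pos fun j _ => by positivity
  have hkf : (0 : ℝ) < k.factorial := by exact_mod_cast k.factorial_pos
  obtain ⟨U, hU⟩ : ∃ U, U = hE.eigenvectorUnitary := ⟨_, rfl⟩
  obtain ⟨e, he⟩ : ∃ e, e = hE.eigenvalues := ⟨_, rfl⟩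
  have hcard : Fintype.card {i // e i ≠ 0} = r := by
    rw [← hrank, hE.rank_eq_card_non_zero_eigs, he]
  have hUU : star (U : Matrix (Fin d) (Fin d) ℂ) * U = 1 := Unitary.coe_star_mul_self U
  have hspec : E = (U : Matrix (Fin d) (Fin d) ℂ) * Matrix.diagonal (fun i => (e i : ℂ)) *
      star (U : Matrix (Fin d) (Fin d) ℂ) := by
    have h := hE.spectral_theorem
    rw [Unitary.conjStarAlgAut_apply, ← hU, ← he] at h
    exact h
  have he01 : ∀ i, e i = 0 ∨ e i = 1 := by
    have h1 : Matrix.diagonal (fun i => (e i : ℂ)) =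
        star (U : Matrix (Fin d) (Fin d) ℂ) * E * (U : Matrix (Fin d) (Fin d) ℂ) := by
      rw [hspec]
      simp only [Matrix.mul_assoc, hUU, Matrix.mul_one]
      rw [← Matrix.mul_assoc, hUU, Matrix.one_mul]
    have h2 : Matrix.diagonal (fun i => (e i : ℂ)) * Matrix.diagonal (fun i => (e i : ℂ)) =
        Matrix.diagonal (fun i => (e i : ℂ)) := by
      have hUU2 : (U : Matrix (Fin d) (Fin d) ℂ) * star (U : Matrix (Fin d) (Fin d) ℂ) = 1 :=
        Unitary.coe_mul_star_self U
      calc _ = star (U : Matrix (Fin d) (Fin d) ℂ) * E * ((U : Matrix (Fin d) (Fin d) ℂ) *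
            star (U : Matrix (Fin d) (Fin d) ℂ)) * E * (U : Matrix (Fin d) (Fin d) ℂ) := by
              rw [h1]; simp only [Matrix.mul_assoc]
        _ = star (U : Matrix (Fin d) (Fin d) ℂ) * (E * E) * (U : Matrix (Fin d) (Fin d) ℂ) := by
              rw [hUU2]; simp only [Matrix.mul_assoc, Matrix.mul_one]
        _ = _ := by rw [hE2, h1]
    intro i
    have h3 := congrFun (congrFun h2 i) i
    rw [Matrix.diagonal_mul_diagonal, Matrix.diagonal_apply_eq, Matrix.diagonal_apply_eq] at h3
    have h4 : e i * e i = e i := by exact_mod_cast h3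
    have h5 : e i * (e i - 1) = 0 := by linarith
    rcases mul_eq_zero.1 h5 with h | h
    · exact Or.inl h
    · exact Or.inr (by linarith)
  have htr : (matTensorPow k E * symProj d k).trace.re = ((r + k - 1).choose k : ℝ) := by
    rw [hspec, trace_conj k _ _ hUU, trace_diag k e he01, hcard]
    simp
  let S : Finset (Fin d) := Finset.univ.filter (fun i => e i ≠ 0)
  have hS : S.card = r := by rw [← hcard, Fintype.card_subtype]
  have hint : ∫ u, ((star u ⬝ᵥ (E *ᵥ u)).re) ^ k ∂μ = ∫ u, XX S u ^ k ∂μ := by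
    have hX := XX_cont S
    rw [← integral_unitary_inv μ hinv (star (U : Matrix (Fin d) (Fin d) ℂ)) (star U).2
      (fun u => XX S u ^ k) (by fun_prop)]
    congr 1
    funext u
    congr 1
    have h1 : star u ⬝ᵥ (E *ᵥ u) = star (star (U : Matrix (Fin d) (Fin d) ℂ) *ᵥ u) ⬝ᵥ
        (Matrix.diagonal (fun i => (e i : ℂ)) *ᵥ (star (U : Matrix (Fin d) (Fin d) ℂ) *ᵥ u)) := by
      conv_lhs => rw [hspec]
      rw [Matrix.star_mulVec, ← Matrix.dotProduct_mulVec, Matrix.star_eq_conjTranspose,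
        Matrix.conjTranspose_conjTranspose, Matrix.mulVec_mulVec, Matrix.mulVec_mulVec,
        Matrix.mul_assoc]
    rw [h1]
    generalize star (U : Matrix (Fin d) (Fin d) ℂ) *ᵥ u = v
    simp only [dotProduct, Matrix.mulVec_diagonal, XX, Complex.re_sum, S, Finset.sum_filter]
    apply Finset.sum_congr rfl
    intro i _
    rcases he01 i with h | h
    · simp [h]
    · simp [h, Complex.sq_norm, Complex.normSq_apply]
  refine ⟨?_, ?_, ?_⟩
  · rw [hint, moment_eq hd μ hunit hinv S k, hS, htr, prod_eq_choose, prod_eq_choose,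
      mul_div_mul_left _ _ hkf.ne']
  · rw [htr]
    have h1 : ((r + k - 1).choose k : ℝ) / ((d + k - 1).choose k : ℝ) =
        (∏ j ∈ Finset.range k, ((r : ℝ) + j)) / ∏ j ∈ Finset.range k, ((d : ℝ) + j) := by
      rw [prod_eq_choose, prod_eq_choose, mul_div_mul_left _ _ hkf.ne']
    rw [h1]
    refine div_le_div_of_nonneg_right ?_ hp.le
    rcases Nat.eq_zero_or_pos r with h0 | h0
    · rw [h0, Finset.prod_eq_zero (Finset.mem_range.2 hk) (by simp)]
      positivity
    · have h0' : (1 : ℝ) ≤ r := by exact_mod_cast h0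
      have : (r : ℝ) ^ k * k.factorial = ∏ j ∈ Finset.range k, ((r : ℝ) * (j + 1)) := by
        rw [Finset.prod_mul_distrib, Finset.prod_const, Finset.card_range,
          ← Finset.prod_range_add_one_eq_factorial]
        push_cast; rfl
      rw [this]
      refine Finset.prod_le_prod (fun j _ => by positivity) fun j _ => ?_
      have : (0 : ℝ) ≤ j := by positivity
      nlinarith
  · rw [div_pow, mul_pow]
    have h1 : (k.factorial : ℝ) ≤ (k : ℝ) ^ k := by exact_mod_cast Nat.factorial_le_pow k
    have h2 : (d : ℝ) ^ k ≤ ∏ j ∈ Finset.range k, ((d : ℝ) + j) := by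
      calc (d : ℝ) ^ k = ∏ j ∈ Finset.range k, (d : ℝ) := by simp
        _ ≤ _ := Finset.prod_le_prod (fun j _ => hd'.le) fun j _ => by simp
    gcongr
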